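/- Let C be a preadditive category with binary biproducts in which the endomorphism ring End(X) of every object X is a semisimple ring. If V is an object such that End(V) is a division ring, then V is minimal: every monomorphism f : W → V is either the zero morphism or an isomorphism. -/

import Mathlib

open CategoryTheory Limits

/-- Semisimple rings are von Neumann regular. -/
theorem IsSemisimpleRing.exists_mul_mul_eq_self {R : Type*} [Ring R] [IsSemisimpleRing R] (a : R) :
    ∃ b : R, a * b * a = a := by
  obtain ⟨e, he, hspan⟩ := IsSemisimpleRing.ideal_eq_span_idempotent (Ideal.span {a})
  obtain ⟨r, rfl⟩ := Ideal.mem_span_singleton'.1 (hspan ▸ Ideal.mem_span_singleton_self a)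
  obtain ⟨s, hs⟩ := Ideal.mem_span_singleton'.1 (hspan.symm ▸ Ideal.mem_span_singleton_self e)
  exact ⟨s, by rw [mul_assoc, hs, mul_assoc, he.eq]⟩

/-- If the endomorphism rings of a preadditive category with binary biproducts are semisimple,
then every morphism has a generalized inverse. -/
theorem CategoryTheory.exists_comp_comp_eq_self_of_isSemisimpleRing_end {C : Type*} [Category C]
    [Preadditive C] [HasBinaryBiproducts C] (hss : ∀ X : C, IsSemisimpleRing (End X))
    {W V : C} (f : W ⟶ V) : ∃ g : V ⟶ W, f ≫ g ≫ f = f := by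
  have := hss (W ⊞ V)
  let a : W ⊞ V ⟶ W ⊞ V := biprod.fst ≫ f ≫ biprod.inr
  obtain ⟨b, hb⟩ := IsSemisimpleRing.exists_mul_mul_eq_self (R := End (W ⊞ V)) a
  have hb' : a ≫ (b : W ⊞ V ⟶ W ⊞ V) ≫ a = a := hb
  refine ⟨biprod.inr ≫ (b : W ⊞ V ⟶ W ⊞ V) ≫ biprod.fst, ?_⟩
  simpa [a] using congr(biprod.inl ≫ $hb' ≫ biprod.snd)

theorem stmt12 (C : Type*) [Category C] [Preadditive C] [HasBinaryBiproducts C]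
    (hss : ∀ X : C, IsSemisimpleRing (End X)) (V : C)
    (hnt : Nontrivial (End V)) (hdiv : ∀ f : End V, f ≠ 0 → IsUnit f) :
    ∀ (W : C) (f : W ⟶ V), Mono f → f = 0 ∨ IsIso f := by
  intro W f _
  refine or_iff_not_imp_left.2 fun hf => ?_
  obtain ⟨g, hg⟩ := exists_comp_comp_eq_self_of_isSemisimpleRing_end hss f
  have : IsIso (g ≫ f) := by
    refine (isUnit_iff_isIso (g ≫ f)).1 (hdiv (g ≫ f) fun h => hf ?_)
    have h' : g ≫ f = 0 := h
    rw [← hg, h', comp_zero]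
  have : IsSplitEpi f := .mk' ⟨inv (g ≫ f) ≫ g, by simp⟩
  exact isIso_of_mono_of_isSplitEpi f
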